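/- arXiv:2210.08480 — 3 statements merged into one kernel-verified Lean document; each statement's English description precedes it below -/
import Mathlib

section
/- If 0 < λᵢ < 1 for all i and the λᵢ are pairwise distinct, then the finite-time volume factor V_N^{λ₁⋯λₙ} = ∑_{(i₁<⋯<iₙ) ⊂ {0,…,N−1}} det[λᵣ^{i_s}] converges as N → ∞ to Φ_{λ₁⋯λₙ} = (∏_{j<k} (λₖ − λⱼ)/(1 − λⱼλₖ)) · ∏ᵢ 1/(1 − λᵢ). -/
/-- The pole-distribution factor `Φ` of a tuple of reals. -/
noncomputable def Phi (m : ℕ) (l : Fin m → ℝ) : ℝ :=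
  (∏ j : Fin m, ∏ k ∈ Finset.Ioi j, (l k - l j) / (1 - l j * l k)) *
    ∏ i : Fin m, (1 - l i)⁻¹

/-- The finite-time volume factor `V_N^{λ₁⋯λₙ}`: the sum, over all strictly
increasing `n`-tuples `(i₁ < ⋯ < iₙ)` of exponents from `{0,…,N-1}`, of the
generalized Vandermonde determinants `det [λᵣ^{i_s}]`. -/
noncomputable def Vfun (n N : ℕ) (l : Fin n → ℝ) : ℝ :=
  ∑ s ∈ ((Finset.range N).powersetCard n).attach,
    Matrix.det (Matrix.of fun r c : Fin n =>
      l r ^ ((s.1.orderIsoOfFin (Finset.mem_powersetCard.mp s.2).2 c : ℕ)))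

open Finset

lemma aux_rec_tendsto (p g : ℝ) (hp0 : 0 ≤ p) (hp1 : p < 1) (x e : ℕ → ℝ)
    (hx : ∀ N, x (N+1) = p * x N + e N) (he : Filter.Tendsto e Filter.atTop (nhds ((1 - p) * g))) :
    Filter.Tendsto x Filter.atTop (nhds g) := by
  rw [Metric.tendsto_atTop] at he ⊢
  intro ε hε
  obtain ⟨N0, hN0⟩ := he ((1 - p) * (ε/2)) (by nlinarith)
  have hb : ∀ k, |x (N0 + k) - g| ≤ p ^ k * |x N0 - g| + ε / 2 := by
    intro k
    induction k with
    | zero => simp; linarith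
    | succ k ih =>
      have h1 : x (N0 + (k+1)) - g = p * (x (N0 + k) - g) + (e (N0 + k) - (1 - p) * g) := by
        rw [← add_assoc, hx]; ring
      have h2 := hN0 (N0 + k) (by omega)
      rw [Real.dist_eq] at h2
      rw [h1]
      refine (abs_add_le _ _).trans ?_
      rw [abs_mul, abs_of_nonneg hp0, pow_succ]
      nlinarith [mul_le_mul_of_nonneg_left ih hp0]
  have ht : Filter.Tendsto (fun k : ℕ => p ^ k * |x N0 - g|) Filter.atTop (nhds 0) := by
    simpa using (tendsto_pow_atTop_nhds_zero_of_lt_one hp0 hp1).mul_const (|x N0 - g|)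
  rw [Metric.tendsto_atTop] at ht
  obtain ⟨K, hK⟩ := ht (ε/2) (by linarith)
  refine ⟨N0 + K, fun n hn => ?_⟩
  obtain ⟨k, rfl⟩ := Nat.exists_eq_add_of_le (show N0 ≤ n by omega)
  have h3 := hK k (by omega)
  rw [Real.dist_eq, sub_zero] at h3
  rw [Real.dist_eq]
  have := le_abs_self (p ^ k * |x N0 - g|)
  linarith [hb k]

noncomputable def auxTup (n N : ℕ) : Finset (Fin n → ℕ) :=
  (Fintype.piFinset fun _ : Fin n => range N).filter StrictMono

lemma mem_auxTup {n N : ℕ} {t : Fin n → ℕ} : t ∈ auxTup n N ↔ (∀ i, t i < N) ∧ StrictMono t := by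
  simp [auxTup]

lemma aux_sum (n N : ℕ) (f : (Fin n → ℕ) → ℝ) :
    ∑ s ∈ ((Finset.range N).powersetCard n).attach,
      f (fun c => (s.1.orderIsoOfFin (Finset.mem_powersetCard.mp s.2).2 c : ℕ)) =
    ∑ t ∈ auxTup n N, f t := by
  refine Finset.sum_bij (fun s _ c => (s.1.orderIsoOfFin (Finset.mem_powersetCard.mp s.2).2 c : ℕ))
    ?_ ?_ ?_ ?_
  · intro s _
    rw [mem_auxTup]
    refine ⟨fun i => ?_, fun a b h => ?_⟩
    · have := (Finset.mem_powersetCard.mp s.2).1 (s.1.orderIsoOfFin (Finset.mem_powersetCard.mp s.2).2 i).2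
      simpa using this
    · simpa using h
  · intro s _ s' _ h
    have h1 := Finset.range_orderEmbOfFin s.1 (Finset.mem_powersetCard.mp s.2).2
    have h2 := Finset.range_orderEmbOfFin s'.1 (Finset.mem_powersetCard.mp s'.2).2
    apply Subtype.ext
    apply Finset.coe_injective
    rw [← h1, ← h2]
    exact congrArg Set.range h
  · intro t ht
    rw [mem_auxTup] at ht
    have hc : (univ.image t).card = n := by
      rw [Finset.card_image_of_injective _ ht.2.injective]; simp
    refine ⟨⟨univ.image t, ?_⟩, by simp, ?_⟩
    · rw [Finset.mem_powersetCard]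
      refine ⟨?_, hc⟩
      intro x hx
      simp only [mem_image, mem_univ, true_and] at hx
      obtain ⟨i, rfl⟩ := hx
      simpa using ht.1 i
    · exact (Finset.orderEmbOfFin_unique hc (fun x => by simp) ht.2).symm
  · intro s _
    rfl

lemma aux_split (n N : ℕ) (f : (Fin (n+1) → ℕ) → ℝ) :
    ∑ t ∈ auxTup (n+1) (N+1), f t =
    ∑ t ∈ auxTup (n+1) N, f (fun i => t i + 1) +
    ∑ t ∈ auxTup n N, f (Fin.cons 0 (fun i => t i + 1)) := by
  rw [← Finset.sum_filter_not_add_sum_filter _ (fun t => t 0 = 0)]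
  congr 1
  · refine Finset.sum_bij' (fun t _ i => t i - 1) (fun t _ i => t i + 1) ?_ ?_ ?_ ?_ ?_
    · intro t ht
      simp only [mem_filter, mem_auxTup] at ht ⊢
      obtain ⟨⟨h1, h2⟩, h3⟩ := ht
      have h4 : ∀ i, t 0 ≤ t i := fun i => h2.monotone (Fin.zero_le i)
      refine ⟨fun i => ?_, fun a b hab => ?_⟩
      · have := h1 i; have := h4 i; omega
      · have := h2 hab; have := h4 a; simp only; omega
    · intro t ht
      simp only [mem_filter, mem_auxTup] at ht ⊢
      exact ⟨⟨fun i => by have := ht.1 i; omega, fun a b hab => by have := ht.2 hab; simp only; omega⟩, by omega⟩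
    · intro t ht
      simp only [mem_filter, mem_auxTup] at ht ⊢
      funext i
      have : t 0 ≤ t i := ht.1.2.monotone (Fin.zero_le i)
      omega
    · intro t ht
      simp
    · intro t ht
      simp only [mem_filter, mem_auxTup] at ht ⊢
      congr 1
      funext i
      have : t 0 ≤ t i := ht.1.2.monotone (Fin.zero_le i)
      omega
  · have hpos : ∀ t : Fin (n+1) → ℕ, StrictMono t → ∀ i : Fin n, 0 < t i.succ := by
      intro t ht i
      exact lt_of_le_of_lt (Nat.zero_le _) (ht (Fin.succ_pos i))
    have hc : ∀ t : Fin (n+1) → ℕ, StrictMono t → t 0 = 0 →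
        (Fin.cons 0 (fun i : Fin n => t i.succ - 1 + 1) : Fin (n+1) → ℕ) = t := by
      intro t ht h0
      funext i
      refine Fin.cases ?_ (fun j => ?_) i
      · simp [h0]
      · have := hpos t ht j
        simp only [Fin.cons_succ]; omega
    refine Finset.sum_bij' (fun t _ i => t i.succ - 1) (fun t _ => Fin.cons 0 (fun i => t i + 1)) ?_ ?_ ?_ ?_ ?_
    · intro t ht
      simp only [mem_filter, mem_auxTup] at ht ⊢
      obtain ⟨⟨h1, h2⟩, h3⟩ := ht
      refine ⟨fun i => ?_, fun a b hab => ?_⟩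
      · have := h1 i.succ; have := hpos t h2 i; omega
      · have := h2 (Fin.succ_lt_succ_iff.mpr hab); have := hpos t h2 a; simp only; omega
    · intro t ht
      simp only [mem_filter, mem_auxTup] at ht ⊢
      refine ⟨⟨fun i => ?_, ?_⟩, by simp⟩
      · refine Fin.cases (by simp) (fun j => ?_) i
        have := ht.1 j
        simp only [Fin.cons_succ]; omega
      · intro a b hab
        induction a using Fin.cases with
        | zero =>
          induction b using Fin.cases with
          | zero => simp at hab
          | succ b => simp
        | succ a =>
          induction b using Fin.cases with
          | zero => simp at hab
          | succ b =>
            have := ht.2 (Fin.succ_lt_succ_iff.mp hab)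
            simp only [Fin.cons_succ]; omega
    · intro t ht
      simp only [mem_filter, mem_auxTup] at ht
      exact hc t ht.1.2 ht.2
    · intro t ht
      simp
    · intro t ht
      simp only [mem_filter, mem_auxTup] at ht
      exact congrArg f (hc t ht.1.2 ht.2).symm

lemma aux_erase {m : ℕ} (i : Fin (m+1)) (g : Fin (m+1) → ℝ) :
    ∏ j ∈ univ.erase i, g j = ∏ j : Fin m, g (i.succAbove j) := by
  have h : (univ.erase i : Finset (Fin (m+1))) = univ.image i.succAbove := by
    rw [Fin.image_succAbove_univ]; ext; simp
  rw [h, Finset.prod_image (fun a _ b _ hab => Fin.succAbove_right_injective hab)]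

lemma aux_ident (n : ℕ) (l : Fin (n+1) → ℝ) (hl : Function.Injective l) (h0 : ∀ i, 0 < l i) :
    1 - ∏ q, l q = ∑ r : Fin (n+1), (1 - l r) * ∏ k : Fin n, (l (r.succAbove k) *
      (1 - l r * l (r.succAbove k)) / (l (r.succAbove k) - l r)) := by
  set P : Polynomial ℝ := ∏ q, (1 - Polynomial.C (l q) * Polynomial.X) with hP
  have hdeg : P.degree ≤ ((n+1 : ℕ) : WithBot ℕ) := by
    refine (Polynomial.degree_prod_le _ _).trans ?_
    refine (Finset.sum_le_sum (g := fun _ => (1 : WithBot ℕ)) fun q _ => ?_).trans ?_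
    · compute_degree
    · simp
  set v : Fin (n+1+1+1) → ℝ := Fin.cons 0 (Fin.cons (-1) l) with hv
  have hvi : Function.Injective v := by
    rw [hv, Fin.cons_injective_iff, Fin.cons_injective_iff]
    refine ⟨?_, ?_, hl⟩
    · rintro ⟨x, hx⟩
      induction x using Fin.cases with
      | zero => simp at hx
      | succ x => simp at hx; exact (h0 x).ne' hx
    · rintro ⟨x, hx⟩
      linarith [h0 x]
  have key := Lagrange.coeff_eq_sum (s := univ) (v := v) (hvi.injOn) (P := P) (by
    refine lt_of_le_of_lt hdeg ?_
    simp only [card_univ, Fintype.card_fin]; norm_cast; omega)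
  have hc : P.coeff (#(univ : Finset (Fin (n+1+1+1))) - 1) = 0 := by
    apply Polynomial.coeff_eq_zero_of_degree_lt
    refine lt_of_le_of_lt hdeg ?_
    simp only [card_univ, Fintype.card_fin]; norm_cast; omega
  rw [hc] at key
  have hev : ∀ x, P.eval x = ∏ q, (1 - l q * x) := by
    intro x; simp [hP, Polynomial.eval_prod]
  simp only [aux_erase, hev] at key
  rw [Fin.sum_univ_succ, Fin.sum_univ_succ] at key
  have hA : (∏ j : Fin (n+1+1), (v 0 - v ((0 : Fin (n+1+1+1)).succAbove j))) = (-1)^(n+1) * ∏ q, l q := by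
    rw [Fin.prod_univ_succ]
    simp [hv, Finset.prod_neg]
  have hB : (∏ j : Fin (n+1+1), (v (Fin.succ 0) - v ((Fin.succ 0 : Fin (n+1+1+1)).succAbove j)))
      = -((-1)^(n+1) * ∏ q, (1 + l q)) := by
    rw [Fin.prod_univ_succ]
    have : ∀ q, (-1 : ℝ) - l q = -(1 + l q) := fun q => by ring
    simp only [hv, Fin.cons_succ, Fin.cons_zero, Fin.succ_succAbove_zero, Fin.succ_succAbove_succ,
      Fin.zero_succAbove, this, Finset.prod_neg]
    simp
  have hC : ∀ r : Fin (n+1), (∏ j : Fin (n+1+1), (v r.succ.succ - v ((r.succ.succ).succAbove j)))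
      = l r * (1 + l r) * ((-1)^n * ∏ k, (l (r.succAbove k) - l r)) := by
    intro r
    rw [Fin.prod_univ_succ, Fin.prod_univ_succ]
    have : ∀ q, l r - l q = -(l q - l r) := fun q => by ring
    simp only [hv, Fin.cons_succ, Fin.cons_zero, Fin.succ_succAbove_zero, Fin.succ_succAbove_succ,
      this (r.succAbove _), Finset.prod_neg]
    simp
    ring
  simp only [hA, hB, hC] at key
  have hp : (∏ q, l q) ≠ 0 := Finset.prod_ne_zero_iff.mpr fun q _ => (h0 q).ne'
  have hp1 : (∏ q, (1 + l q)) ≠ 0 := Finset.prod_ne_zero_iff.mpr fun q _ => by linarith [h0 q]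
  have e0 : (∏ q, (1 - l q * v 0)) = 1 := by simp [hv]
  have e1 : (∏ q, (1 - l q * v (Fin.succ 0))) = ∏ q, (1 + l q) := by simp [hv]
  have e2 : ∀ r : Fin (n+1), (∏ q, (1 - l q * v r.succ.succ)) =
      (1 - l r) * (1 + l r) * ∏ k, (1 - l r * l (r.succAbove k)) := by
    intro r
    rw [Fin.prod_univ_succAbove _ r]
    simp only [hv, Fin.cons_succ]
    congr 1
    · ring
    · exact Finset.prod_congr rfl fun k _ => by ring
  simp only [e0, e1, e2] at key
  have hs : ((-1:ℝ)^n) * (-1)^n = 1 := by rw [← mul_pow]; simp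
  have hterm : ∀ r : Fin (n+1), (1 - l r) * ∏ k : Fin n, (l (r.succAbove k) *
      (1 - l r * l (r.succAbove k)) / (l (r.succAbove k) - l r)) = ((-1)^n * ∏ q, l q) *
      ((1 - l r) * (1 + l r) * (∏ k, (1 - l r * l (r.succAbove k))) / 
        (l r * (1 + l r) * ((-1)^n * ∏ k, (l (r.succAbove k) - l r)))) := by
    intro r
    rw [Fin.prod_univ_succAbove _ r, Finset.prod_div_distrib, Finset.prod_mul_distrib]
    have a1 := (h0 r).ne'
    have a2 : 1 + l r ≠ 0 := by linarith [h0 r]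
    have a3 : (∏ k, (l (r.succAbove k) - l r)) ≠ 0 := Finset.prod_ne_zero_iff.mpr fun k _ =>
      sub_ne_zero.mpr fun h => Fin.succAbove_ne r k (hl h)
    have a4 : ((-1:ℝ)^n) ≠ 0 := by simp
    field_simp
  rw [Finset.sum_congr rfl fun r _ => hterm r, ← Finset.mul_sum]
  have h5 := eq_neg_of_add_eq_zero_right (a := 1 / ((-1:ℝ)^(n+1) * ∏ q, l q) + (∏ q, (1 + l q)) / (-((-1)^(n+1) * ∏ q, (1 + l q)))) (by rw [add_assoc]; exact key.symm)
  rw [h5, pow_succ]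
  have a4 : ((-1:ℝ)^n) ≠ 0 := by simp
  field_simp
  ring

lemma aux_sign (n : ℕ) (r : Fin (n+1)) :
    ∏ k : Fin n, (if r < r.succAbove k then (1:ℝ) else -1) = (-1) ^ (r : ℕ) := by
  rw [Finset.prod_ite]
  simp only [prod_const_one, one_mul, prod_const]
  congr 1
  have : (univ.filter fun k : Fin n => ¬ r < r.succAbove k) = univ.filter fun k : Fin n => (k : ℕ) < r := by
    ext k
    simp only [mem_filter, mem_univ, true_and, Fin.lt_succAbove_iff_le_castSucc, not_le]
    simp only [Fin.lt_def, Fin.val_castSucc]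
  rw [this, Fin.card_filter_val_lt]
  omega

lemma aux_pairs (n : ℕ) (g : Fin (n+1) → Fin (n+1) → ℝ) (r : Fin (n+1)) :
    ∏ j, ∏ k ∈ Ioi j, g j k = (∏ j : Fin n, ∏ k ∈ Ioi j, g (r.succAbove j) (r.succAbove k)) *
      ∏ k : Fin n, (if r < r.succAbove k then g r (r.succAbove k) else g (r.succAbove k) r) := by
  have h : ∀ (m : ℕ) (g : Fin m → Fin m → ℝ), ∏ j, ∏ k ∈ Ioi j, g j k =
      ∏ j, ∏ k, if j < k then g j k else 1 := by
    intro m g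
    refine Finset.prod_congr rfl fun j _ => ?_
    rw [← Finset.prod_filter]
    congr 1
    ext; simp
  rw [h, h, Fin.prod_univ_succAbove _ r]
  simp only [Fin.prod_univ_succAbove _ r, lt_irrefl, if_false, one_mul, Fin.succAbove_lt_succAbove_iff]
  rw [Finset.prod_mul_distrib, ← mul_assoc, ← Finset.prod_mul_distrib, mul_comm]
  congr 1
  refine Finset.prod_congr rfl fun k _ => ?_
  have := Fin.succAbove_ne r k
  rcases lt_or_gt_of_ne this with h | h
  · simp [h, h.not_gt]
  · simp [h, h.not_gt]

lemma aux_Phi (n : ℕ) (l : Fin (n+1) → ℝ) (r : Fin (n+1)) :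
    Phi (n+1) l = Phi n (fun k => l (r.succAbove k)) * (-1) ^ (r : ℕ) * (1 - l r)⁻¹ *
      ∏ k : Fin n, ((l (r.succAbove k) - l r) / (1 - l r * l (r.succAbove k))) := by
  unfold Phi
  rw [aux_pairs n _ r, Fin.prod_univ_succAbove _ r]
  have : ∏ k : Fin n, (if r < r.succAbove k then (l (r.succAbove k) - l r) / (1 - l r * l (r.succAbove k))
      else (l r - l (r.succAbove k)) / (1 - l (r.succAbove k) * l r)) = (-1) ^ (r : ℕ) *
      ∏ k : Fin n, ((l (r.succAbove k) - l r) / (1 - l r * l (r.succAbove k))) := by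
    rw [← aux_sign, ← Finset.prod_mul_distrib]
    refine Finset.prod_congr rfl fun k _ => ?_
    split_ifs
    · simp
    · rw [mul_comm (l (r.succAbove k)) (l r), ← mul_div_assoc]; congr 1; ring
  rw [this]
  ring

lemma aux_Phi_rec (n : ℕ) (l : Fin (n+1) → ℝ) (hl : Function.Injective l) (h0 : ∀ i, 0 < l i)
    (h1 : ∀ i, l i < 1) :
    ∑ r : Fin (n+1), (-1) ^ (r : ℕ) * (∏ k, l (r.succAbove k)) * Phi n (fun k => l (r.succAbove k))
      = (1 - ∏ q, l q) * Phi (n+1) l := by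
  rw [aux_ident n l hl h0, Finset.sum_mul]
  refine Finset.sum_congr rfl fun r _ => ?_
  rw [aux_Phi n l r, Finset.prod_div_distrib, Finset.prod_mul_distrib, Finset.prod_div_distrib]
  have a1 : 1 - l r ≠ 0 := by linarith [h1 r]
  have a3 : (∏ k, (l (r.succAbove k) - l r)) ≠ 0 := Finset.prod_ne_zero_iff.mpr fun k _ =>
    sub_ne_zero.mpr fun h => Fin.succAbove_ne r k (hl h)
  have a4 : (∏ k, (1 - l r * l (r.succAbove k))) ≠ 0 := Finset.prod_ne_zero_iff.mpr fun k _ => by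
    have := h1 r; have := h1 (r.succAbove k); have := h0 r; have := h0 (r.succAbove k)
    nlinarith
  field_simp

lemma aux_V (n N : ℕ) (l : Fin n → ℝ) :
    Vfun n N l = ∑ t ∈ auxTup n N, Matrix.det (Matrix.of fun r c : Fin n => l r ^ t c) :=
  aux_sum n N fun t => Matrix.det (Matrix.of fun r c : Fin n => l r ^ t c)

lemma aux_det (n : ℕ) (l : Fin n → ℝ) (t : Fin n → ℕ) :
    Matrix.det (Matrix.of fun r c : Fin n => l r ^ (t c + 1)) =
      (∏ q, l q) * Matrix.det (Matrix.of fun r c : Fin n => l r ^ t c) := by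
  rw [← Matrix.det_mul_column]
  simp only [pow_succ', Matrix.of_apply]

lemma aux_V_rec (n N : ℕ) (l : Fin (n+1) → ℝ) :
    Vfun (n+1) (N+1) l = (∏ q, l q) * Vfun (n+1) N l +
      ∑ r : Fin (n+1), (-1) ^ (r : ℕ) * (∏ k, l (r.succAbove k)) *
        Vfun n N (fun k => l (r.succAbove k)) := by
  simp only [aux_V]
  rw [aux_split]
  simp only [aux_det]
  rw [← Finset.mul_sum]
  congr 1
  simp only [Finset.mul_sum]
  rw [Finset.sum_comm]
  refine Finset.sum_congr rfl fun t _ => ?_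
  rw [Matrix.det_succ_column_zero]
  refine Finset.sum_congr rfl fun r _ => ?_
  rw [mul_assoc _ (∏ k, l (r.succAbove k)), ← aux_det]
  simp only [Matrix.of_apply, Fin.cons_zero, pow_zero, mul_one]
  rfl

theorem Vfun_tendsto_Phi (n : ℕ) (l : Fin n → ℝ) (hl : Function.Injective l)
    (h0 : ∀ i, 0 < l i) (h1 : ∀ i, l i < 1) :
    Filter.Tendsto (fun N => Vfun n N l) Filter.atTop (nhds (Phi n l)) := by
  induction n with
  | zero =>
    have : ∀ N, Vfun 0 N l = Phi 0 l := by
      intro N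
      simp [Vfun, Phi]
    simp only [this]
    exact tendsto_const_nhds
  | succ n ih =>
    refine aux_rec_tendsto (∏ q, l q) _ (Finset.prod_nonneg fun q _ => (h0 q).le) ?_ _ _
      (fun N => aux_V_rec n N l) ?_
    · rw [Fin.prod_univ_succ]
      have := Finset.prod_le_one (s := univ) (f := fun i : Fin n => l i.succ)
        (fun i _ => (h0 _).le) (fun i _ => (h1 _).le)
      have := h0 0
      have := h1 0
      nlinarith
    · rw [← aux_Phi_rec n l hl h0 h1]
      refine tendsto_finsetSum _ fun r _ => ?_
      exact (ih (fun k => l (r.succAbove k)) (hl.comp Fin.succAbove_right_injective)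
        (fun _ => h0 _) (fun _ => h1 _)).const_mul _
end

section
/- (Main theorem, n=3 instance) For pairwise distinct λ₁, λ₂, λ₃ (each ≠ 1, pairwise products ≠ 1, triple product ≠ 1) and N ≥ 3: ∑_{0 ≤ i < j < k ≤ N−1} det[λᵣ^{(i,j,k)_s}] = (1 + (λ₁λ₂λ₃)^N) Φ_{λ₁λ₂λ₃} − (λ₁^N + (λ₂λ₃)^N) Φ_{λ₁} Φ_{λ₂λ₃} + (λ₂^N + (λ₁λ₃)^N) Φ_{λ₂} Φ_{λ₁λ₃} − (λ₃^N + (λ₁λ₂)^N) Φ_{λ₃} Φ_{λ₁λ₂}. -/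
theorem sum_one_aux (a : ℝ) (ha : a ≠ 1) (j : ℕ) :
    ∑ i ∈ Finset.range j, a ^ i = (1 - a ^ j) / (1 - a) := by
  rw [geom_sum_eq ha, ← neg_div_neg_eq]; simp

theorem sum_two_aux (a b : ℝ) (ha : a ≠ 1) (hb : b ≠ 1) (hab : a * b ≠ 1) (k : ℕ) :
    ∑ j ∈ Finset.range k, ∑ i ∈ Finset.range j, (a ^ i * b ^ j - b ^ i * a ^ j) =
      (a ^ k - b ^ k) / ((1 - a) * (1 - b)) +
        (1 - a ^ k * b ^ k) * (b - a) / ((1 - a) * (1 - b) * (1 - a * b)) := by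
  have h1 : 1 - a ≠ 0 := sub_ne_zero.mpr ha.symm
  have h2 : 1 - b ≠ 0 := sub_ne_zero.mpr hb.symm
  have h3 : 1 - a * b ≠ 0 := sub_ne_zero.mpr hab.symm
  induction k with
  | zero => simp
  | succ k ih =>
    rw [Finset.sum_range_succ, ih, Finset.sum_sub_distrib, ← Finset.sum_mul, ← Finset.sum_mul,
      sum_one_aux a ha, sum_one_aux b hb, pow_succ, pow_succ]
    generalize a ^ k = x
    generalize b ^ k = y
    field_simp
    ring

theorem sum_three_aux (a b c : ℝ) (ha : a ≠ 1) (hb : b ≠ 1) (hc : c ≠ 1)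
    (hab : a * b ≠ 1) (hac : a * c ≠ 1) (hbc : b * c ≠ 1) (N : ℕ) :
    ∑ k ∈ Finset.range N, ∑ j ∈ Finset.range k, ∑ i ∈ Finset.range j,
      ((a ^ i * b ^ j - b ^ i * a ^ j) * c ^ k - (a ^ i * c ^ j - c ^ i * a ^ j) * b ^ k
        + (b ^ i * c ^ j - c ^ i * b ^ j) * a ^ k) =
      (1 + a ^ N * b ^ N * c ^ N) * ((b - a) * (c - a) * (c - b) /
        ((1 - a * b) * (1 - a * c) * (1 - b * c) * ((1 - a) * (1 - b) * (1 - c))))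
      - (a ^ N + b ^ N * c ^ N) * ((c - b) / ((1 - b * c) * ((1 - a) * (1 - b) * (1 - c))))
      + (b ^ N + a ^ N * c ^ N) * ((c - a) / ((1 - a * c) * ((1 - a) * (1 - b) * (1 - c))))
      - (c ^ N + a ^ N * b ^ N) * ((b - a) / ((1 - a * b) * ((1 - a) * (1 - b) * (1 - c)))) := by
  have h1 : 1 - a ≠ 0 := sub_ne_zero.mpr ha.symm
  have h2 : 1 - b ≠ 0 := sub_ne_zero.mpr hb.symm
  have h3 : 1 - c ≠ 0 := sub_ne_zero.mpr hc.symm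
  have h4 : 1 - a * b ≠ 0 := sub_ne_zero.mpr hab.symm
  have h5 : 1 - a * c ≠ 0 := sub_ne_zero.mpr hac.symm
  have h6 : 1 - b * c ≠ 0 := sub_ne_zero.mpr hbc.symm
  have h4' : 1 - b * a ≠ 0 := by rwa [mul_comm b a]
  have h5' : 1 - c * a ≠ 0 := by rwa [mul_comm c a]
  have h6' : 1 - c * b ≠ 0 := by rwa [mul_comm c b]
  induction N with
  | zero => simp; field_simp; ring
  | succ k ih =>
    rw [Finset.sum_range_succ, ih]
    simp only [Finset.sum_add_distrib, Finset.sum_sub_distrib, ← Finset.sum_mul]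
    simp only [← Finset.sum_sub_distrib, Finset.sum_mul]
    simp only [← Finset.sum_mul, ← Finset.sum_sub_distrib]
    have e1 := sum_two_aux a b ha hb hab k
    have e2 := sum_two_aux a c ha hc hac k
    have e3 := sum_two_aux b c hb hc hbc k
    simp only [Finset.sum_sub_distrib, ← Finset.sum_mul] at e1 e2 e3 ⊢
    rw [e1, e2, e3, pow_succ, pow_succ, pow_succ]
    generalize a ^ k = x
    generalize b ^ k = y
    generalize c ^ k = z
    field_simp
    ring

theorem Vfun_three (N : ℕ) (l : Fin 3 → ℝ) :
    Vfun 3 N l = ∑ k ∈ Finset.range N, ∑ j ∈ Finset.range k, ∑ i ∈ Finset.range j,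
      ((l 0 ^ i * l 1 ^ j - l 1 ^ i * l 0 ^ j) * l 2 ^ k
        - (l 0 ^ i * l 2 ^ j - l 2 ^ i * l 0 ^ j) * l 1 ^ k
        + (l 1 ^ i * l 2 ^ j - l 2 ^ i * l 1 ^ j) * l 0 ^ k) := by
  have hs : ∀ k, ∀ F : ℕ → ℕ → ℝ, ∑ j ∈ Finset.range k, ∑ i ∈ Finset.range j, F i j =
      ∑ p ∈ (Finset.range k).sigma (fun j => Finset.range j), F p.2 p.1 := by
    intro k F; rw [Finset.sum_sigma]
  simp only [hs]
  rw [← Finset.sum_sigma (Finset.range N)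
    (fun k => (Finset.range k).sigma (fun j => Finset.range j))
    (fun q => ((l 0 ^ q.2.2 * l 1 ^ q.2.1 - l 1 ^ q.2.2 * l 0 ^ q.2.1) * l 2 ^ q.1
        - (l 0 ^ q.2.2 * l 2 ^ q.2.1 - l 2 ^ q.2.2 * l 0 ^ q.2.1) * l 1 ^ q.1
        + (l 1 ^ q.2.2 * l 2 ^ q.2.1 - l 2 ^ q.2.2 * l 1 ^ q.2.1) * l 0 ^ q.1))]
  unfold Vfun
  refine Finset.sum_bij (fun s _ =>
    (⟨s.1.orderEmbOfFin (Finset.mem_powersetCard.mp s.2).2 2,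
      s.1.orderEmbOfFin (Finset.mem_powersetCard.mp s.2).2 1,
      s.1.orderEmbOfFin (Finset.mem_powersetCard.mp s.2).2 0⟩ : (_ : ℕ) × (_ : ℕ) × ℕ)) ?_ ?_ ?_ ?_
  · intro s _
    have hp := Finset.mem_powersetCard.mp s.2
    simp only [Finset.mem_sigma, Finset.mem_range]
    refine ⟨Finset.mem_range.mp (hp.1 (Finset.orderEmbOfFin_mem _ _ _)), ?_, ?_⟩
    · exact (Finset.orderEmbOfFin _ _).strictMono (by decide)
    · exact (Finset.orderEmbOfFin _ _).strictMono (by decide)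
  · intro s _ t _ h
    simp only [Sigma.mk.injEq, heq_eq_eq] at h
    obtain ⟨h2, h1, h0⟩ := h
    apply Subtype.ext
    apply Finset.coe_injective
    rw [← Finset.range_orderEmbOfFin s.1 (Finset.mem_powersetCard.mp s.2).2,
      ← Finset.range_orderEmbOfFin t.1 (Finset.mem_powersetCard.mp t.2).2]
    congr 1
    funext x
    fin_cases x
    · exact h0
    · exact h1
    · exact h2
  · rintro ⟨k, j, i⟩ h
    simp only [Finset.mem_sigma, Finset.mem_range] at h
    obtain ⟨hk, hj, hi⟩ := h
    have hcard : ({i, j, k} : Finset ℕ).card = 3 := by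
      rw [Finset.card_eq_three]
      exact ⟨i, j, k, by omega, by omega, by omega, rfl⟩
    have hmem : ({i, j, k} : Finset ℕ) ∈ (Finset.range N).powersetCard 3 := by
      rw [Finset.mem_powersetCard]
      refine ⟨?_, hcard⟩
      intro x hx
      simp only [Finset.mem_insert, Finset.mem_singleton] at hx
      rw [Finset.mem_range]
      omega
    refine ⟨⟨_, hmem⟩, Finset.mem_attach _ _, ?_⟩
    have hu := Finset.orderEmbOfFin_unique hcard (f := ![i, j, k])
      (by intro x; fin_cases x <;> simp)
      (by
        intro x y hxy
        fin_cases x <;> fin_cases y <;> simp at hxy ⊢ <;> omega)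
    simp only [← hu]
    simp
  · intro s _
    rw [Matrix.det_fin_three]
    simp only [Matrix.of_apply, Finset.coe_orderIsoOfFin_apply]
    ring

/-- Main theorem, `n = 3` instance (Eq. (51)). -/
theorem main_theorem_n3 (l1 l2 l3 : ℝ)
    (h12 : l1 ≠ l2) (h13 : l1 ≠ l3) (h23 : l2 ≠ l3)
    (e1 : l1 ≠ 1) (e2 : l2 ≠ 1) (e3 : l3 ≠ 1)
    (p12 : l1 * l2 ≠ 1) (p13 : l1 * l3 ≠ 1) (p23 : l2 * l3 ≠ 1)
    (p123 : l1 * l2 * l3 ≠ 1) (N : ℕ) (hN : 3 ≤ N) :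
    Vfun 3 N ![l1, l2, l3] =
      (1 + (l1 * l2 * l3) ^ N) * Phi 3 ![l1, l2, l3]
        - (l1 ^ N + (l2 * l3) ^ N) * Phi 1 ![l1] * Phi 2 ![l2, l3]
        + (l2 ^ N + (l1 * l3) ^ N) * Phi 1 ![l2] * Phi 2 ![l1, l3]
        - (l3 ^ N + (l1 * l2) ^ N) * Phi 1 ![l3] * Phi 2 ![l1, l2] := by
  have i30 : Finset.Ioi (0 : Fin 3) = {1, 2} := by decide
  have i31 : Finset.Ioi (1 : Fin 3) = {2} := by decide
  have i32 : Finset.Ioi (2 : Fin 3) = ∅ := by decide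
  have i20 : Finset.Ioi (0 : Fin 2) = {1} := by decide
  have i21 : Finset.Ioi (1 : Fin 2) = ∅ := by decide
  have i10 : Finset.Ioi (0 : Fin 1) = ∅ := by decide
  have P1 : ∀ a : ℝ, Phi 1 ![a] = (1 - a)⁻¹ := by
    intro a; simp [Phi, i10]
  have P2 : ∀ a b : ℝ, Phi 2 ![a, b] = (b - a) / (1 - a * b) * ((1 - a)⁻¹ * (1 - b)⁻¹) := by
    intro a b; simp [Phi, Fin.prod_univ_two, i20, i21, mul_comm]
  have P3 : ∀ a b c : ℝ, Phi 3 ![a, b, c] =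
      ((b - a) / (1 - a * b) * ((c - a) / (1 - a * c))) * ((c - b) / (1 - b * c)) *
        ((1 - a)⁻¹ * (1 - b)⁻¹ * (1 - c)⁻¹) := by
    intro a b c
    simp only [Phi, Fin.prod_univ_three, i30, i31, i32]
    rw [Finset.prod_pair (by decide)]
    simp
  rw [Vfun_three, P1, P1, P1, P2, P2, P2, P3]
  have := sum_three_aux l1 l2 l3 e1 e2 e3 p12 p13 p23 N
  simp only [Matrix.cons_val]
  rw [this]
  simp only [mul_pow, div_eq_mul_inv, mul_inv]
  ring
end

section
/- (Main theorem, general n) For pairwise distinct reals λ₁,…,λₙ with all denominators nonzero (λᵢ ≠ 1, λᵢλⱼ ≠ 1 for i<j) and N ≥ n, the sum V_N = ∑_{0 ≤ i₁ < ⋯ < iₙ ≤ N−1} det[λᵣ^{i_s}] equals ∑_{S ⊆ {1,…,n}} (−1)^{(n+1)|S| − ∑_{j∈S} j} (∏_{j∈S} λⱼ^N) Φ_S Φ_{Sᶜ}, where Φ_T = (∏_{j<k, j,k∈T} (λₖ − λⱼ)/(1 − λⱼλₖ)) · ∏_{i∈T} 1/(1 − λᵢ) and Φ_∅ = 1. 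-/
/-- The pole-distribution factor `Φ_T` of the subtuple of `λ` indexed by the
finite set `T` (with the inherited index order); `Φ_∅ = 1`. -/
noncomputable def PhiSet (n : ℕ) (l : Fin n → ℝ) (T : Finset (Fin n)) : ℝ :=
  (∏ j ∈ T, ∏ k ∈ T.filter (fun k => j < k), (l k - l j) / (1 - l j * l k)) *
    ∏ i ∈ T, (1 - l i)⁻¹

section AlgebraPart

open Finset Polynomial

noncomputable def cpair {ι : Type*} (l : ι → ℝ) (i j : ι) : ℝ := (1 - l i * l j) / (l j - l i)

noncomputable def Cross {ι : Type*} (l : ι → ℝ) (S R : Finset ι) : ℝ :=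
  ∏ i ∈ S, ∏ j ∈ R, cpair l i j

noncomputable def eps (n s : ℕ) : ℝ := (-1) ^ (n * s + s.choose 2)

noncomputable def Ufun {ι : Type*} [DecidableEq ι] (l : ι → ℝ) (N : ℕ) (T : Finset ι) : ℝ :=
  ∑ S ∈ T.powerset, eps T.card S.card * (∏ i ∈ S, l i ^ N) * Cross l S (T \ S)

lemma eps_succ (n s : ℕ) : eps n (s+1) = eps n s * (-1)^n * (-1)^s := by
  unfold eps
  rw [Nat.choose_succ_succ' s 1, Nat.choose_one_right]
  simp only [← pow_add]
  congr 1
  ring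

lemma neg_one_sq_pow (s : ℕ) : ((-1:ℝ)^s) * (-1)^s = 1 := by
  rw [← mul_pow]; norm_num

lemma eps_succ_succ (m s : ℕ) : eps (m+1) (s+1) = eps m s * (-1)^(m+1) := by
  rw [eps_succ]
  have : eps (m+1) s = eps m s * (-1)^s := by
    unfold eps; rw [← pow_add]; congr 1; ring
  rw [this]
  linear_combination (eps m s * (-1)^(m+1)) * neg_one_sq_pow s

lemma natDegree_lin (a b : ℝ) : (C a - C b * X : ℝ[X]).natDegree ≤ 1 := by
  compute_degree

lemma natDegree_linprod {ι : Type*} (S : Finset ι) (a b : ι → ℝ) :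
    (∏ i ∈ S, (C (a i) - C (b i) * X : ℝ[X])).natDegree ≤ S.card := by
  refine (natDegree_prod_le _ _).trans ?_
  refine (Finset.sum_le_card_nsmul _ _ 1 fun i _ => natDegree_lin _ _).trans ?_
  simp

lemma coeff_linprod {ι : Type*} (S : Finset ι) (a b : ι → ℝ) :
    (∏ i ∈ S, (C (a i) - C (b i) * X : ℝ[X])).coeff S.card = (-1)^S.card * ∏ i ∈ S, b i := by
  have := coeff_prod_of_natDegree_le (s := S) (fun i => (C (a i) - C (b i) * X : ℝ[X])) 1
    (fun i _ => natDegree_lin _ _)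
  rw [mul_one] at this
  rw [this]
  simp [coeff_C, Finset.prod_neg]

lemma eval_linprod {ι : Type*} (S : Finset ι) (a b : ι → ℝ) (x : ℝ) :
    (∏ i ∈ S, (C (a i) - C (b i) * X : ℝ[X])).eval x = ∏ i ∈ S, (a i - b i * x) := by
  simp [eval_prod]

lemma identA {ι : Type*} [DecidableEq ι] (l : ι → ℝ) (hl : Function.Injective l) (S : Finset ι) :
    ∑ r ∈ S, (1 - l r) * ∏ j ∈ S.erase r, cpair l r j = 1 - ∏ i ∈ S, l i := by
  rcases S.eq_empty_or_nonempty with rfl | hS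
  · simp
  have hc : 0 < S.card := hS.card_pos
  set A : Finset ι → ℝ[X] := fun T => ∏ i ∈ T, (C 1 - C (l i) * X) with hA
  set B : Finset ι → ℝ[X] := fun T => ∏ i ∈ T, (C (l i) - C 1 * X) with hB
  have hdvd : (X - C (-1 : ℝ)) ∣ A S - B S := by
    rw [dvd_iff_isRoot, IsRoot.def, eval_sub]
    simp only [hA, hB]
    rw [eval_linprod, eval_linprod, sub_eq_zero]
    exact prod_congr rfl fun i _ => by ring
  obtain ⟨P, hP⟩ := hdvd
  have hne : (X - C (-1 : ℝ)) ≠ 0 := X_sub_C_ne_zero _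
  have hdegQ : (A S - B S).natDegree ≤ S.card :=
    (natDegree_sub_le _ _).trans (max_le (natDegree_linprod _ _ _) (natDegree_linprod _ _ _))
  have hdeg : P.degree < S.card := by
    by_cases hP0 : P = 0
    · simp [hP0]
    rw [hP, natDegree_mul hne hP0, natDegree_X_sub_C] at hdegQ
    rw [degree_eq_natDegree hP0]
    exact_mod_cast (by omega)
  have hcoeff : P.coeff (S.card - 1) = (-1)^S.card * (∏ i ∈ S, l i - 1) := by
    have h := congrArg (fun q => q.coeff S.card) hP
    simp only [hA, hB, coeff_sub] at h
    rw [coeff_linprod, coeff_linprod, sub_mul, coeff_sub] at h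
    obtain ⟨k, hk⟩ : ∃ k, S.card = k + 1 := ⟨S.card - 1, by omega⟩
    have h0 : P.coeff S.card = 0 := coeff_eq_zero_of_degree_lt hdeg
    rw [coeff_C_mul, h0] at h
    rw [hk] at h ⊢
    rw [coeff_X_mul] at h
    simp only [Nat.add_sub_cancel]
    rw [prod_const_one] at h
    linarith
  have hev : ∀ r ∈ S, P.eval (l r) = (1 - l r) * ∏ j ∈ S.erase r, (1 - l r * l j) := by
    intro r hr
    have hAr : A S = (C 1 - C (l r) * X) * A (S.erase r) := (mul_prod_erase S _ hr).symm
    have hBr : B S = (C (l r) - C 1 * X) * B (S.erase r) := (mul_prod_erase S _ hr).symm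
    have hAe : (A (S.erase r)).eval (l r) = ∏ j ∈ S.erase r, (1 - l r * l j) := by
      simp only [hA]; rw [eval_linprod]; exact prod_congr rfl fun i _ => by ring
    by_cases h : l r = -1
    · have hP2 : P = A (S.erase r) + B (S.erase r) := by
        apply mul_left_cancel₀ hne
        rw [← hP, hAr, hBr, h]
        simp only [map_neg, map_one]
        ring
      have hBe : (B (S.erase r)).eval (l r) = ∏ j ∈ S.erase r, (1 - l r * l j) := by
        simp only [hB]; rw [eval_linprod]; exact prod_congr rfl fun i _ => by rw [h]; ring
      rw [hP2, eval_add, hAe, hBe, h]; ring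
    · have h3 := congrArg (eval (l r)) hP
      rw [hAr, hBr] at h3
      simp only [eval_sub, eval_mul, eval_C, eval_X, hAe] at h3
      have : l r - -1 ≠ 0 := by intro h'; exact h (by linarith)
      apply mul_left_cancel₀ this
      rw [← h3]; ring
  have := Lagrange.coeff_eq_sum (s := S) (v := l) hl.injOn hdeg
  rw [hcoeff] at this
  have h5 : ∀ r ∈ S, (1 - l r) * ∏ j ∈ S.erase r, cpair l r j =
      (-1)^(S.card - 1) * (P.eval (l r) / ∏ j ∈ S.erase r, (l r - l j)) := by
    intro r hr
    rw [hev r hr, ← card_erase_of_mem hr, mul_div_assoc, ← prod_div_distrib, mul_left_comm]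
    congr 1
    rw [← prod_const, ← prod_mul_distrib]
    refine prod_congr rfl fun j _ => ?_
    unfold cpair
    rw [← neg_sub (l r) (l j), div_neg]; ring
  rw [sum_congr rfl h5, ← mul_sum, ← this]
  obtain ⟨k, hk⟩ : ∃ k, S.card = k + 1 := ⟨S.card - 1, by omega⟩
  rw [hk, Nat.add_sub_cancel]
  linear_combination (1 - ∏ i ∈ S, l i) * neg_one_sq_pow k

lemma Cross_insert_left {ι : Type*} [DecidableEq ι] (l : ι → ℝ) (S R : Finset ι) (a : ι) (ha : a ∉ S) :
    Cross l (insert a S) R = (∏ j ∈ R, cpair l a j) * Cross l S R := by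
  unfold Cross; rw [prod_insert ha]

lemma Cross_insert_right {ι : Type*} [DecidableEq ι] (l : ι → ℝ) (S R : Finset ι) (a : ι) (ha : a ∉ R) :
    Cross l S (insert a R) = (∏ i ∈ S, cpair l i a) * Cross l S R := by
  unfold Cross; rw [← prod_mul_distrib]; exact prod_congr rfl fun i _ => by rw [prod_insert ha]

lemma Ufun_step {ι : Type*} [DecidableEq ι] (l : ι → ℝ) (hl : Function.Injective l) (N m : ℕ)
    (T : Finset ι) (hT : T.card = m + 1) :
    Ufun l (N+1) T = Ufun l N T + (-1)^m * ∑ r ∈ T, l r ^ N * (1 - l r) *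
      (∏ j ∈ T.erase r, cpair l r j) * Ufun l N (T.erase r) := by
  rw [← sub_eq_iff_eq_add']
  have key : ∀ S ∈ T.powerset, eps T.card S.card * (∏ i ∈ S, l i ^ (N+1)) * Cross l S (T \ S)
      - eps T.card S.card * (∏ i ∈ S, l i ^ N) * Cross l S (T \ S)
      = ∑ r ∈ S, (-1)^m * (l r ^ N * (1 - l r) * (∏ j ∈ T.erase r, cpair l r j) *
        (eps m (S.erase r).card * (∏ i ∈ S.erase r, l i ^ N) *
          Cross l (S.erase r) (T \ S))) := by
    intro S hS
    rw [mem_powerset] at hS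
    have hA := identA l hl S
    have : ∀ r ∈ S, (-1)^m * (l r ^ N * (1 - l r) * (∏ j ∈ T.erase r, cpair l r j) *
        (eps m (S.erase r).card * (∏ i ∈ S.erase r, l i ^ N) *
          Cross l (S.erase r) (T \ S))) = (- (eps T.card S.card * (∏ i ∈ S, l i ^ N) * Cross l S (T \ S)))
          * ((1 - l r) * ∏ j ∈ S.erase r, cpair l r j) := by
      intro r hr
      have e1 : T.erase r = S.erase r ∪ (T \ S) := by grind
      have e2 : Disjoint (S.erase r) (T \ S) := by
        rw [Finset.disjoint_left]; grind
      rw [e1, prod_union e2]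
      have e3 : Cross l S (T \ S) = (∏ j ∈ T \ S, cpair l r j) * Cross l (S.erase r) (T \ S) := by
        rw [← Cross_insert_left _ _ _ _ (notMem_erase r S), insert_erase hr]
      have e4 : ∏ i ∈ S, l i ^ N = l r ^ N * ∏ i ∈ S.erase r, l i ^ N :=
        (mul_prod_erase S _ hr).symm
      have e5 : S.card = (S.erase r).card + 1 := (card_erase_add_one hr).symm
      rw [e3, e4, e5, hT, eps_succ_succ]
      ring
    rw [sum_congr rfl this, ← mul_sum, hA]
    simp only [pow_succ, prod_mul_distrib]
    ring
  unfold Ufun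
  rw [← sum_sub_distrib, sum_congr rfl key, mul_sum]
  rw [sum_comm' (t' := T) (s' := fun r => T.powerset.filter (fun S => r ∈ S)) (by
    intro S r; simp only [mem_powerset, mem_filter]; grind)]
  refine sum_congr rfl fun r hr => ?_
  rw [card_erase_of_mem hr, hT, Nat.add_sub_cancel]
  rw [mul_sum, mul_sum]
  refine sum_bij' (fun S _ => S.erase r) (fun S _ => insert r S) ?_ ?_ ?_ ?_ ?_
  · intro S hS; simp only [mem_filter, mem_powerset] at hS ⊢; exact erase_subset_erase _ hS.1
  · intro S hS; simp only [mem_filter, mem_powerset] at hS ⊢; grind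
  · intro S hS; simp only [mem_filter] at hS; exact insert_erase hS.2
  · intro S hS; simp only [mem_powerset] at hS; exact erase_insert (by grind)
  · intro S hS
    simp only [mem_filter, mem_powerset] at hS
    have : T.erase r \ S.erase r = T \ S := by grind
    rw [this]

lemma Ufun_zero {ι : Type*} [DecidableEq ι] (l : ι → ℝ) (hl : Function.Injective l)
    (h1 : ∀ i, l i ≠ 1) (T : Finset ι) (hT : T.Nonempty) : Ufun l 0 T = 0 := by
  obtain ⟨a, ha⟩ := hT
  obtain ⟨R, haR, rfl⟩ : ∃ R, a ∉ R ∧ T = insert a R :=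
    ⟨T.erase a, notMem_erase a T, (insert_erase ha).symm⟩
  set A : Finset ι → ℝ[X] := fun T => ∏ i ∈ T, (C 1 - C (l i) * X) with hA
  set B : Finset ι → ℝ[X] := fun T => ∏ i ∈ T, (C (l i) - C 1 * X) with hB
  set n := R.card + 1 with hn
  set F : Finset ι → ℝ[X] := fun S =>
    C (eps n S.card * (-1)^S.card * Cross l S (R \ S)) * (A S * B (R \ S)) with hF
  set G : Finset ι → ℝ[X] := fun S =>
    C (eps n S.card * (-1)^(n + S.card) * Cross l S (R \ S)) * (A (R \ S) * B S) with hG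
  set P : ℝ[X] := ∑ S ∈ R.powerset, (F S + G S) with hP
  have evA : ∀ S x, (A S).eval x = ∏ i ∈ S, (1 - l i * x) := fun S x => eval_linprod _ _ _ _
  have evB : ∀ S x, (B S).eval x = ∏ i ∈ S, (l i - x) := fun S x => by
    simp only [hB]; rw [eval_linprod]; simp
  have dA : ∀ S, (A S).natDegree ≤ S.card := fun S => natDegree_linprod _ _ _
  have dB : ∀ S, (B S).natDegree ≤ S.card := fun S => natDegree_linprod _ _ _
  have hdeg : P.natDegree ≤ R.card := by
    refine natDegree_sum_le_of_forall_le _ _ fun S hS => ?_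
    rw [mem_powerset] at hS
    have hc := card_sdiff_add_card_eq_card hS
    refine (natDegree_add_le _ _).trans (max_le ?_ ?_)
    · refine (natDegree_C_mul_le _ _).trans (natDegree_mul_le.trans ?_)
      have := dA S; have := dB (R \ S); omega
    · refine (natDegree_C_mul_le _ _).trans (natDegree_mul_le.trans ?_)
      have := dB S; have := dA (R \ S); omega
  have root1 : P.eval 1 = 0 := by
    rw [hP, eval_finsetSum]
    refine sum_eq_zero fun S hS => ?_
    rw [mem_powerset] at hS
    have hc := card_sdiff_add_card_eq_card hS
    simp only [hF, hG, eval_add, eval_mul, eval_C, evA, evB, mul_one]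
    have e : ∀ Q : Finset ι, ∏ i ∈ Q, (l i - 1) = (-1)^Q.card * ∏ i ∈ Q, (1 - l i) := by
      intro Q
      rw [← prod_const, ← prod_mul_distrib]; exact prod_congr rfl fun i _ => by ring
    rw [e, e]
    have hn' : n = (R \ S).card + S.card + 1 := by omega
    rw [hn']
    simp only [pow_add, pow_one]
    linear_combination (-eps ((R \ S).card + S.card + 1) S.card * Cross l S (R \ S) * (∏ i ∈ S, (1 - l i)) *
      (∏ i ∈ R \ S, (1 - l i)) * (-1)^(R \ S).card * (-1)^S.card) * neg_one_sq_pow S.card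
  have rootk : ∀ k ∈ R, P.eval (l k) = 0 := by
    intro k hk
    obtain ⟨Q, hkQ, hRQ⟩ : ∃ Q, k ∉ Q ∧ R = insert k Q :=
      ⟨R.erase k, notMem_erase k R, (insert_erase hk).symm⟩
    rw [hP, hRQ, sum_powerset_insert hkQ, ← sum_add_distrib, eval_finsetSum]
    refine sum_eq_zero fun S hS => ?_
    rw [mem_powerset] at hS
    have hkS : k ∉ S := fun h => hkQ (hS h)
    have e1 : insert k Q \ S = insert k (Q \ S) := by grind
    have e2 : insert k Q \ insert k S = Q \ S := by grind
    have hk' : k ∉ Q \ S := by grind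
    have hlk : ∀ i ∈ Q, l i - l k ≠ 0 := fun i hi h => hkQ (by
      have := hl (sub_eq_zero.mp h); rwa [this] at hi)
    simp only [hF, hG, hRQ, e1, e2, eval_add, eval_mul, eval_C, evA, evB, prod_insert hkS,
      prod_insert hk', Cross_insert_left _ _ _ _ hkS, Cross_insert_right _ _ _ _ hk', sub_self,
      card_insert_of_notMem hkS, eps_succ]
    have t1 : (∏ j ∈ Q \ S, cpair l k j) * ∏ j ∈ Q \ S, (l j - l k) = ∏ j ∈ Q \ S, (1 - l j * l k) := by
      rw [← prod_mul_distrib]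
      refine prod_congr rfl fun j hj => ?_
      unfold cpair
      rw [div_mul_cancel₀ _ (hlk j (by grind))]; ring
    have t2 : (∏ j ∈ S, cpair l j k) * ∏ j ∈ S, (l j - l k) = (-1)^S.card * ∏ j ∈ S, (1 - l j * l k) := by
      rw [← prod_mul_distrib, ← prod_const, ← prod_mul_distrib]
      refine prod_congr rfl fun j hj => ?_
      unfold cpair
      rw [← neg_sub (l j) (l k), div_neg, neg_mul, div_mul_cancel₀ _ (hlk j (by grind))]; ring
    simp only [pow_add, pow_one]
    generalize (∏ j ∈ Q \ S, (l j - l k)) = x1 at *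
    generalize (∏ j ∈ S, (l j - l k)) = x2 at *
    generalize (∏ j ∈ Q \ S, cpair l k j) = x3 at *
    generalize (∏ j ∈ S, cpair l j k) = x4 at *
    generalize (∏ j ∈ S, (1 - l j * l k)) = x5 at *
    rw [← t1]
    have h6 := neg_one_sq_pow S.card
    generalize ((-1:ℝ)^S.card) = x6 at *
    linear_combination (eps n S.card * (-1)^n * x6 * Cross l S (Q \ S) * (1 - l k * l k) * x3 * x1) * t2
  have hP0 : P = 0 := by
    refine eq_zero_of_degree_lt_of_eval_finset_eq_zero (insert 1 (R.image l)) ?_ ?_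
    · rw [card_insert_of_notMem (by simp [h1]), card_image_of_injective _ hl]
      refine (degree_le_natDegree).trans_lt ?_
      exact_mod_cast (by omega)
    · intro x hx
      rw [mem_insert, mem_image] at hx
      rcases hx with rfl | ⟨k, hk, rfl⟩
      · exact root1
      · exact rootk k hk
  have hla : ∀ i ∈ R, l i - l a ≠ 0 := fun i hi h => haR (by
      have := hl (sub_eq_zero.mp h); rwa [this] at hi)
  have hBne : ∏ i ∈ R, (l i - l a) ≠ 0 := prod_ne_zero_iff.mpr hla
  apply mul_right_cancel₀ hBne
  rw [zero_mul]
  have : P.eval (l a) = 0 := by rw [hP0, eval_zero]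
  rw [← this, hP, eval_finsetSum]
  unfold Ufun
  rw [sum_powerset_insert haR, ← sum_add_distrib, sum_mul]
  refine sum_congr rfl fun S hS => ?_
  rw [mem_powerset] at hS
  have haS : a ∉ S := fun h => haR (hS h)
  have e1 : insert a R \ S = insert a (R \ S) := by grind
  have e2 : insert a R \ insert a S = R \ S := by grind
  have ha' : a ∉ R \ S := by grind
  simp only [hF, hG, e1, e2, eval_add, eval_mul, eval_C, evA, evB,
      Cross_insert_left _ _ _ _ haS, Cross_insert_right _ _ _ _ ha', 
      card_insert_of_notMem haS, card_insert_of_notMem haR, eps_succ, pow_zero, prod_const_one]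
  have t1 : (∏ j ∈ R \ S, cpair l a j) * ∏ j ∈ R \ S, (l j - l a) = ∏ j ∈ R \ S, (1 - l j * l a) := by
    rw [← prod_mul_distrib]
    refine prod_congr rfl fun j hj => ?_
    unfold cpair
    rw [div_mul_cancel₀ _ (hla j (by grind))]; ring
  have t2 : (∏ j ∈ S, cpair l j a) * ∏ j ∈ S, (l j - l a) = (-1)^S.card * ∏ j ∈ S, (1 - l j * l a) := by
    rw [← prod_mul_distrib, ← prod_const, ← prod_mul_distrib]
    refine prod_congr rfl fun j hj => ?_
    unfold cpair
    rw [← neg_sub (l j) (l a), div_neg, neg_mul, div_mul_cancel₀ _ (hla j (hS hj))]; ring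
  rw [← prod_sdiff hS, ← t1]
  simp only [pow_add, ← hn]
  linear_combination (eps n S.card * Cross l S (R \ S) * (∏ j ∈ R \ S, (l j - l a))) * t2

end AlgebraPart

open Finset

lemma Ufun_map {ι κ : Type*} [DecidableEq ι] [DecidableEq κ] (l : ι → ℝ) (f : κ ↪ ι) (N : ℕ)
    (T : Finset κ) : Ufun (l ∘ f) N T = Ufun l N (T.map f) := by
  unfold Ufun
  have hpow : (T.map f).powerset = T.powerset.map (mapEmbedding f).toEmbedding := by
    ext S
    simp only [mem_powerset, mem_map, RelEmbedding.coe_toEmbedding, mapEmbedding_apply]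
    constructor
    · intro h
      obtain ⟨u, hu, rfl⟩ := subset_map_iff.mp h
      exact ⟨u, hu, rfl⟩
    · rintro ⟨u, hu, rfl⟩
      exact map_subset_map.mpr hu
  rw [hpow, sum_map]
  refine sum_congr rfl fun S _ => ?_
  simp only [RelEmbedding.coe_toEmbedding, mapEmbedding_apply, card_map, prod_map]
  have : T.map f \ S.map f = (T \ S).map f := by
    simp only [map_eq_image]; exact (image_sdiff _ _ f.injective).symm
  rw [this]
  unfold Cross cpair
  simp only [prod_map, Function.comp]

noncomputable def sgnProd {n : ℕ} (S R : Finset (Fin n)) : ℝ :=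
  ∏ i ∈ S, ∏ j ∈ R, (if j < i then (-1 : ℝ) else 1)

lemma PhiSet_map {m n : ℕ} (l : Fin n → ℝ) (f : Fin m ↪o Fin n) (T : Finset (Fin m)) :
    PhiSet m (l ∘ f) T = PhiSet n l (T.map f.toEmbedding) := by
  unfold PhiSet
  simp only [prod_filter, prod_map]
  simp

lemma PhiSet_split {n : ℕ} (l : Fin n → ℝ) (hl : Function.Injective l)
    (h2 : ∀ i j, i ≠ j → l i * l j ≠ 1) (S R : Finset (Fin n)) (hd : Disjoint S R) :
    PhiSet n l S * PhiSet n l R = PhiSet n l (S ∪ R) * Cross l S R * sgnProd S R := by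
  unfold PhiSet Cross sgnProd
  simp only [prod_filter]
  rw [prod_union hd, prod_union hd]
  simp only [prod_union hd, prod_mul_distrib]
  rw [prod_comm (s := R) (t := S)]
  have key : (∏ i ∈ S, ∏ j ∈ R, if i < j then (l j - l i) / (1 - l i * l j) else 1) *
    (∏ i ∈ S, ∏ j ∈ R, if j < i then (l i - l j) / (1 - l j * l i) else 1) *
    (∏ i ∈ S, ∏ j ∈ R, cpair l i j) * (∏ i ∈ S, ∏ j ∈ R, (if j < i then (-1 : ℝ) else 1)) = 1 := by
    simp only [← prod_mul_distrib]
    refine prod_eq_one fun i hi => prod_eq_one fun j hj => ?_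
    have hij : i ≠ j := fun h => (Finset.disjoint_left.mp hd hi) (h ▸ hj)
    have a1 : l j - l i ≠ 0 := fun h => hij (hl (sub_eq_zero.mp h)).symm
    have a2 : 1 - l i * l j ≠ 0 := fun h => h2 i j hij (sub_eq_zero.mp h).symm
    unfold cpair
    rcases lt_or_gt_of_ne hij with h | h
    · simp only [h, not_lt_of_gt h, if_true, if_false]
      rw [mul_one, mul_one, div_mul_div_cancel₀ a2, div_self a1]
    · simp only [h, not_lt_of_gt h, if_true, if_false]
      rw [mul_comm (l j), ← neg_sub (l j) (l i), one_mul, div_mul_div_cancel₀ a2, neg_div, div_self a1]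
      norm_num
  linear_combination (-(∏ i ∈ S, ∏ j ∈ S, if i < j then (l j - l i) / (1 - l i * l j) else 1) *
    (∏ i ∈ R, ∏ j ∈ R, if i < j then (l j - l i) / (1 - l i * l j) else 1) *
    (∏ i ∈ S, (1 - l i)⁻¹) * ∏ i ∈ R, (1 - l i)⁻¹) * key

lemma prod_lt_univ {n : ℕ} (i : Fin n) : (∏ j : Fin n, (if j < i then (-1 : ℝ) else 1)) = (-1)^(i:ℕ) := by
  rw [← prod_filter, prod_const]
  congr 1
  have : univ.filter (fun j => j < i) = Iio i := by ext; simp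
  rw [this, Fin.card_Iio]

lemma sgnProd_self {n : ℕ} (S : Finset (Fin n)) : sgnProd S S = (-1)^(S.card.choose 2) := by
  induction S using Finset.induction_on_max with
  | empty => simp [sgnProd]
  | insert a S ha ih =>
    have haS : a ∉ S := fun h => lt_irrefl _ (ha a h)
    unfold sgnProd at ih ⊢
    rw [prod_insert haS, prod_insert haS, card_insert_of_notMem haS, Nat.choose_succ_succ' _ 1,
      Nat.choose_one_right, pow_add, ← ih, if_neg (lt_irrefl _), one_mul]
    congr 1
    · rw [← prod_const]; exact prod_congr rfl fun j hj => if_pos (ha j hj)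
    · refine prod_congr rfl fun i hi => ?_
      rw [prod_insert haS, if_neg (not_lt_of_gt (ha i hi)), one_mul]

lemma sgnProd_compl {n : ℕ} (S : Finset (Fin n)) :
    (-1 : ℝ) ^ ((((n : ℤ) + 1) * (S.card : ℤ)) - ∑ j ∈ S, ((j : ℤ) + 1)) =
      eps n S.card * sgnProd S Sᶜ := by
  have h : sgnProd S S * sgnProd S Sᶜ = (-1)^(∑ i ∈ S, (i:ℕ)) := by
    unfold sgnProd
    rw [← prod_mul_distrib, ← prod_pow_eq_pow_sum]
    refine prod_congr rfl fun i _ => ?_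
    rw [prod_mul_prod_compl, prod_lt_univ]
  rw [sgnProd_self] at h
  have e : (((n : ℤ) + 1) * (S.card : ℤ)) - ∑ j ∈ S, ((j : ℤ) + 1)
      = ((n * S.card : ℕ) : ℤ) - ((∑ i ∈ S, (i:ℕ) : ℕ) : ℤ) := by
    rw [sum_add_distrib]; push_cast; simp; ring
  rw [e, zpow_sub₀ (by norm_num), zpow_natCast, zpow_natCast, ← h]
  unfold eps
  rw [pow_add, h]
  have h3 := neg_one_sq_pow (∑ i ∈ S, (i:ℕ))
  have h4 := neg_one_sq_pow (S.card.choose 2)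
  rw [div_eq_iff (by intro h0; rw [h0] at h3; norm_num at h3), ← h]
  have h5 : sgnProd S Sᶜ * sgnProd S Sᶜ = 1 := by
    rw [← h] at h3
    linear_combination h3 - sgnProd S Sᶜ * sgnProd S Sᶜ * h4
  linear_combination (-(-1)^(n * S.card)) * h5 - (-1)^(n * S.card) * sgnProd S Sᶜ * sgnProd S Sᶜ * h4

/-- determinant attached to a finite set of exponents -/
noncomputable def detSet (n : ℕ) (l : Fin n → ℝ) (s : Finset ℕ) : ℝ :=
  if h : s.card = n then Matrix.det (Matrix.of fun r c : Fin n => l r ^ (s.orderEmbOfFin h c)) else 0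

lemma Vfun_eq (n N : ℕ) (l : Fin n → ℝ) :
    Vfun n N l = ∑ s ∈ (range N).powersetCard n, detSet n l s := by
  unfold Vfun
  rw [← sum_attach ((range N).powersetCard n)]
  refine sum_congr rfl fun s _ => ?_
  unfold detSet
  rw [dif_pos (mem_powersetCard.mp s.2).2]
  rfl

lemma detSet_insert (m N : ℕ) (l : Fin (m+1) → ℝ) (s : Finset ℕ) (hs : s ∈ (range N).powersetCard m) :
    detSet (m+1) l (insert N s) =
      ∑ r : Fin (m+1), (-1)^((r:ℕ) + m) * l r ^ N * detSet m (l ∘ r.succAbove) s := by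
  obtain ⟨hsub, hc⟩ := mem_powersetCard.mp hs
  have hN : N ∉ s := fun h => by simpa using hsub h
  have hc' : (insert N s).card = m + 1 := by rw [card_insert_of_notMem hN, hc]
  have hlt : ∀ i, s.orderEmbOfFin hc i < N := fun i => by
    simpa using hsub (s.orderEmbOfFin_mem hc i)
  have huniq := orderEmbOfFin_unique hc'
    (f := Fin.snoc (α := fun _ => ℕ) (fun i => s.orderEmbOfFin hc i) N) (by
      intro x
      refine Fin.lastCases ?_ (fun i => ?_) x
      · simp
      · simp) (by
      intro x y
      refine Fin.lastCases ?_ (fun i => ?_) y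
      · refine Fin.lastCases ?_ (fun i => ?_) x
        · simp
        · intro _; simpa using hlt i
      · refine Fin.lastCases ?_ (fun j => ?_) x
        · intro h; exact absurd h (not_lt_of_gt (Fin.castSucc_lt_last i))
        · intro h; simpa using h)
  unfold detSet
  rw [dif_pos hc', Matrix.det_succ_column _ (Fin.last m)]
  refine sum_congr rfl fun r _ => ?_
  rw [dif_pos hc, ← huniq]
  congr 1
  · simp
  · congr 1
    ext i j
    simp

lemma Vfun_step (m N : ℕ) (l : Fin (m+1) → ℝ) :
    Vfun (m+1) (N+1) l = Vfun (m+1) N l +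
      ∑ r : Fin (m+1), (-1)^((r:ℕ) + m) * l r ^ N * Vfun m N (l ∘ r.succAbove) := by
  simp only [Vfun_eq]
  have hN : N ∉ range N := by simp
  rw [range_add_one, powersetCard_succ_insert hN, sum_union]
  · congr 1
    rw [sum_image]
    · rw [sum_congr rfl fun s hs => detSet_insert m N l s hs, sum_comm]
      simp only [mul_sum]
    · intro s hs t ht h
      have a : N ∉ s := fun h => by simpa using (mem_powersetCard.mp hs).1 h
      have b : N ∉ t := fun h => by simpa using (mem_powersetCard.mp ht).1 h
      rw [← erase_insert a, ← erase_insert b]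
      exact congrArg (fun u => u.erase N) h
  · rw [Finset.disjoint_left]
    intro s hs h
    obtain ⟨t, _, rfl⟩ := mem_image.mp h
    simpa using (mem_powersetCard.mp hs).1 (mem_insert_self N t)

lemma PhiSet_erase {m : ℕ} (l : Fin (m+1) → ℝ) (hl : Function.Injective l) (h1 : ∀ i, l i ≠ 1)
    (h2 : ∀ i j, i ≠ j → l i * l j ≠ 1) (r : Fin (m+1)) :
    PhiSet (m+1) l (univ.erase r) = PhiSet (m+1) l univ * (1 - l r) *
      (∏ j ∈ univ.erase r, cpair l r j) * (-1)^(r:ℕ) := by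
  have h := PhiSet_split l hl h2 {r} (univ.erase r) (by simp)
  have e : ({r} : Finset (Fin (m+1))) ∪ univ.erase r = univ := by
    ext x; simp [em]
  rw [e] at h
  have e2 : PhiSet (m+1) l {r} = (1 - l r)⁻¹ := by
    unfold PhiSet; simp [filter_singleton]
  have e3 : sgnProd {r} (univ.erase r) = (-1)^(r:ℕ) := by
    unfold sgnProd
    rw [prod_singleton, ← prod_lt_univ, ← mul_prod_erase univ _ (mem_univ r)]
    simp
  rw [e2, e3] at h
  unfold Cross at h
  rw [prod_singleton] at h
  have hr : 1 - l r ≠ 0 := fun h => h1 r (sub_eq_zero.mp h).symm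
  field_simp at h
  rw [h]; ring

lemma main_aux (N : ℕ) : ∀ (n : ℕ) (l : Fin n → ℝ) (_ : Function.Injective l) (_ : ∀ i, l i ≠ 1)
    (_ : ∀ i j, i ≠ j → l i * l j ≠ 1),
    Vfun n N l = PhiSet n l univ * Ufun l N univ := by
  induction N with
  | zero =>
    intro n l hl h1 h2
    rcases n with _ | m
    · simp [Vfun_eq, detSet, PhiSet, Ufun, eps, Cross]
    · rw [Ufun_zero l hl h1 _ univ_nonempty, Vfun_eq, powersetCard_eq_empty.mpr (by simp)]
      simp
  | succ N ih =>
    intro n l hl h1 h2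
    rcases n with _ | m
    · simp [Vfun_eq, detSet, PhiSet, Ufun, eps, Cross]
    · rw [Vfun_step, Ufun_step l hl N m univ (by simp), ih _ l hl h1 h2, mul_add, mul_sum, mul_sum]
      congr 1
      refine sum_congr rfl fun r _ => ?_
      have e : univ.map r.succAboveOrderEmb.toEmbedding = univ.erase r := by
        ext x
        simp only [mem_map, mem_univ, true_and, mem_erase, and_true]
        exact Fin.exists_succAbove_eq_iff
      rw [ih m (l ∘ r.succAbove) (hl.comp Fin.succAbove_right_injective) (fun i => h1 _)
        (fun i j hij => h2 _ _ (fun h => hij (Fin.succAbove_right_injective h)))]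
      have e1 := PhiSet_map l r.succAboveOrderEmb univ
      have e2 := Ufun_map l r.succAboveOrderEmb.toEmbedding N univ
      rw [e] at e1 e2
      have e3 : PhiSet m (l ∘ r.succAbove) univ = PhiSet (m+1) l (univ.erase r) := e1
      have e4 : Ufun (l ∘ r.succAbove) N univ = Ufun l N (univ.erase r) := e2
      rw [e3, e4, PhiSet_erase l hl h1 h2, pow_add]
      linear_combination ((-1)^m * l r ^ N * PhiSet (m+1) l univ * (1 - l r) *
        (∏ j ∈ univ.erase r, cpair l r j) * Ufun l N (univ.erase r)) * neg_one_sq_pow (r:ℕ)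
/-- Main theorem (Theorem 4, Eq. (45)): for `N ≥ n`,
`V_N^{λ₁⋯λₙ} = ∑_{S ⊆ {1,…,n}} (-1)^{(n+1)|S| - ∑_{j∈S} j} (∏_{j∈S} λⱼ^N) Φ_S Φ_{Sᶜ}`,
where the index sum uses 1-based indices. -/
theorem main_theorem_general (n N : ℕ) (l : Fin n → ℝ)
    (hl : Function.Injective l) (h1 : ∀ i, l i ≠ 1)
    (h2 : ∀ i j, i ≠ j → l i * l j ≠ 1) (hN : n ≤ N) :
    Vfun n N l =
      ∑ S : Finset (Fin n),
        (-1 : ℝ) ^ ((((n : ℤ) + 1) * (S.card : ℤ)) - ∑ j ∈ S, ((j : ℤ) + 1)) *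
          (∏ j ∈ S, l j ^ N) * PhiSet n l S * PhiSet n l Sᶜ := by

  rw [main_aux N n l hl h1 h2]
  unfold Ufun
  rw [powerset_univ, mul_sum]
  refine sum_congr rfl fun S _ => ?_
  have h := PhiSet_split l hl h2 S Sᶜ disjoint_compl_right
  rw [union_compl] at h
  rw [mul_assoc _ (PhiSet n l S), h, sgnProd_compl, card_univ, Fintype.card_fin, ← compl_eq_univ_sdiff]
  have h5 : sgnProd S Sᶜ * sgnProd S Sᶜ = 1 := by
    unfold sgnProd
    simp only [← prod_mul_distrib]
    refine prod_eq_one fun i _ => prod_eq_one fun j _ => ?_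
    split_ifs <;> norm_num
  linear_combination (-eps n S.card * (∏ j ∈ S, l j ^ N) * PhiSet n l univ * Cross l S Sᶜ) * h5
end
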